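/- For 1 ≤ i < j < n, the following identity holds in the group algebra K[S_n]: S_{j,n−j}·S_{i,j−i} = S_{i,n−i}·S_{j−i,n−j}^{↑i}, where S_{p,q} denotes the sum of all (p,q)-shuffles (suitably embedded) and S_{j−i,n−j}^{↑i} is the sum of (j−i,n−j)-shuffles shifted to act on positions i+1,…,n. -/

import Mathlib

def IsShuffleOn {n : ℕ} (i p q : ℕ) (σ : Equiv.Perm (Fin n)) : Prop :=
  (∀ a : Fin n, ((a : ℕ) < i ∨ i + p + q ≤ (a : ℕ)) → σ a = a) ∧
  (∀ a b : Fin n, a < b → i ≤ (a : ℕ) → (b : ℕ) < i + p → σ.symm a < σ.symm b) ∧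
  (∀ a b : Fin n, a < b → i + p ≤ (a : ℕ) → (b : ℕ) < i + p + q → σ.symm a < σ.symm b)

open scoped Classical in
/-- The partial symmetrization element `S_{p,q}^{↑i} ∈ K[S_n]`: the sum of all
`(p,q)`-shuffles shifted to act on positions `i+1,…,i+p+q`. -/
noncomputable def shuffleSum (K : Type*) [CommRing K] (n i p q : ℕ) :
    MonoidAlgebra K (Equiv.Perm (Fin n)) :=
  ∑ σ : Equiv.Perm (Fin n),
    if IsShuffleOn i p q σ then MonoidAlgebra.single σ (1 : K) else 0

/-- The inverse of `σ` is strictly increasing on the positions in `[l, r)`. -/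
def IncreasingOn {n : ℕ} (σ : Equiv.Perm (Fin n)) (l r : ℕ) : Prop :=
  ∀ a b : Fin n, a < b → l ≤ (a : ℕ) → (b : ℕ) < r → σ.symm a < σ.symm b

/-- `σ` fixes every position outside `[l, r)`. -/
def FixesOutside {n : ℕ} (σ : Equiv.Perm (Fin n)) (l r : ℕ) : Prop :=
  ∀ a : Fin n, ((a : ℕ) < l ∨ r ≤ (a : ℕ)) → σ a = a

namespace FixesOutside

variable {n l r : ℕ} {σ τ : Equiv.Perm (Fin n)}

theorem symm (h : FixesOutside σ l r) : FixesOutside σ.symm l r := fun a ha => by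
  rw [Equiv.symm_apply_eq, h a ha]

theorem mul (hσ : FixesOutside σ l r) (hτ : FixesOutside τ l r) :
    FixesOutside (σ * τ) l r := fun a ha => by
  rw [Equiv.Perm.mul_apply, hτ a ha, hσ a ha]

theorem apply_mem (h : FixesOutside σ l r) {a : Fin n} (hl : l ≤ (a : ℕ))
    (hr : (a : ℕ) < r) : l ≤ (σ a : ℕ) ∧ (σ a : ℕ) < r := by
  by_contra hc
  have h1 : σ (σ a) = σ a := h _ (by omega)
  rw [σ.injective h1] at hc
  exact hc ⟨hl, hr⟩

/-- A permutation supported on an interval and increasing there is the identity. -/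
theorem eq_one (h : FixesOutside σ l r)
    (hlt : ∀ a b : Fin n, a < b → l ≤ (a : ℕ) → (b : ℕ) < r → σ a < σ b) : σ = 1 := by
  have hm : StrictMono σ := by
    intro a b hab
    by_cases ha : (a : ℕ) < l ∨ r ≤ (a : ℕ) <;> by_cases hb : (b : ℕ) < l ∨ r ≤ (b : ℕ)
    · rwa [h a ha, h b hb]
    · have := h.apply_mem (a := b) (by omega) (by omega)
      rw [h a ha, Fin.lt_def]
      rw [Fin.lt_def] at hab
      omega
    · have := h.apply_mem (a := a) (by omega) (by omega)
      rw [h b hb, Fin.lt_def]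
      rw [Fin.lt_def] at hab
      omega
    · exact hlt a b hab (by omega) (by omega)
  have hid := (hm.range_inj strictMono_id).1
    (by rw [σ.surjective.range_eq, Set.range_id])
  ext a
  simp [hid]

end FixesOutside

/-- Any injective sequence can be sorted along an interval by permuting only the positions
of that interval. -/
theorem exists_fixesOutside_increasingOn {n : ℕ} (l r : ℕ) (w : Equiv.Perm (Fin n)) :
    ∃ σ : Equiv.Perm (Fin n), FixesOutside σ l r ∧ IncreasingOn (σ⁻¹ * w) l r := by
  classical
  let s : Finset (Fin n) := Finset.univ.filter fun a => l ≤ (a : ℕ) ∧ (a : ℕ) < r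
  let t : Finset (Fin n) := s.map w.symm.toEmbedding
  have ht : t.card = s.card := Finset.card_map _
  let e : s ≃o t := (s.orderIsoOfFin rfl).symm.trans (t.orderIsoOfFin ht)
  let g : t ≃ s := w.subtypeEquiv fun a => by simp [t, Finset.mem_map_equiv]
  refine ⟨Equiv.Perm.ofSubtype (e.toEquiv.trans g), fun a ha => ?_, fun a b hab ha hb => ?_⟩
  · apply Equiv.Perm.ofSubtype_apply_of_not_mem
    simp only [s, Finset.mem_filter, Finset.mem_univ, true_and]
    omega
  · have has : a ∈ s := by
      simp only [s, Finset.mem_filter, Finset.mem_univ, true_and]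
      rw [Fin.lt_def] at hab
      omega
    have hbs : b ∈ s := by
      simp only [s, Finset.mem_filter, Finset.mem_univ, true_and]
      rw [Fin.lt_def] at hab
      omega
    have key : ∀ c (hc : c ∈ s),
        ((Equiv.Perm.ofSubtype (e.toEquiv.trans g))⁻¹ * w).symm c = e ⟨c, hc⟩ := by
      intro c hc
      rw [Equiv.symm_apply_eq, Equiv.Perm.mul_apply, Equiv.Perm.eq_inv_iff_eq,
        Equiv.Perm.ofSubtype_apply_of_mem _ hc]
      rfl
    rw [key a has, key b hbs]
    exact e.strictMono (a := ⟨a, has⟩) (b := ⟨b, hbs⟩) hab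

/-- Factoring permutations whose inverse is increasing on three blocks, two of which are
adjacent: first shuffle the adjacent blocks `[l, m)` and `[m, r)`, then shuffle the resulting
block `[l, r)` with the remaining block `[u, v)`. -/
theorem sum_single_mul_sum_single (K : Type*) [CommRing K] {n l m r u v : ℕ}
    (hlm : l ≤ m) (hmr : m ≤ r) (huv : v ≤ l ∨ r ≤ u)
    (P Q T : Finset (Equiv.Perm (Fin n)))
    (hP : ∀ σ, σ ∈ P ↔ FixesOutside σ l r ∧ IncreasingOn σ l m ∧ IncreasingOn σ m r)
    (hQ : ∀ σ, σ ∈ Q ↔ IncreasingOn σ l r ∧ IncreasingOn σ u v)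
    (hT : ∀ σ, σ ∈ T ↔ IncreasingOn σ l m ∧ IncreasingOn σ m r ∧ IncreasingOn σ u v) :
    (∑ σ ∈ P, MonoidAlgebra.single σ (1 : K)) * ∑ σ ∈ Q, MonoidAlgebra.single σ (1 : K) =
      ∑ σ ∈ T, MonoidAlgebra.single σ (1 : K) := by
  rw [Finset.sum_mul_sum, ← Finset.sum_product']
  refine Finset.sum_bij (fun x _ => x.1 * x.2) ?_ ?_ ?_ ?_
  · rintro ⟨σ, τ⟩ h
    rw [Finset.mem_product, hP, hQ] at h
    obtain ⟨⟨hf, h1, h2⟩, h3, h4⟩ := h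
    rw [hT]
    refine ⟨fun a b hab ha hb => ?_, fun a b hab ha hb => ?_, fun a b hab ha hb => ?_⟩ <;>
      change τ.symm (σ.symm a) < τ.symm (σ.symm b) <;>
      have hab' := Fin.lt_def.1 hab
    · exact h3 _ _ (h1 a b hab ha hb) (hf.symm.apply_mem (by omega) (by omega)).1
        (hf.symm.apply_mem (by omega) (by omega)).2
    · exact h3 _ _ (h2 a b hab ha hb) (hf.symm.apply_mem (by omega) (by omega)).1
        (hf.symm.apply_mem (by omega) (by omega)).2
    · rw [hf.symm a (by omega), hf.symm b (by omega)]
      exact h4 a b hab ha hb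
  · rintro ⟨σ, τ⟩ h ⟨σ', τ'⟩ h' heq
    rw [Finset.mem_product, hP, hQ] at h h'
    obtain ⟨⟨hf, -, -⟩, h3, -⟩ := h
    obtain ⟨⟨hf', -, -⟩, h3', -⟩ := h'
    dsimp only at heq hf hf' h3 h3'
    have hc : FixesOutside (σ⁻¹ * σ') l r := hf.symm.mul hf'
    have hτ : ∀ a, τ'.symm a = τ.symm ((σ⁻¹ * σ') a) := by
      intro a
      have h1 : τ = σ⁻¹ * σ' * τ' := by rw [mul_assoc, ← heq, inv_mul_cancel_left]
      rw [Equiv.eq_symm_apply]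
      conv_lhs => rw [h1]
      simp
    have h1 : σ⁻¹ * σ' = 1 := hc.eq_one fun a b hab ha hb => by
      have hab' := Fin.lt_def.1 hab
      have hlt := h3' a b hab ha hb
      rw [hτ, hτ] at hlt
      by_contra hle
      rcases (not_lt.1 hle).lt_or_eq with hgt | he
      · exact lt_asymm hlt (h3 _ _ hgt (hc.apply_mem (by omega) (by omega)).1
          (hc.apply_mem (by omega) (by omega)).2)
      · rw [he] at hlt
        exact lt_irrefl _ hlt
    have hσ : σ = σ' := inv_mul_eq_one.1 h1
    subst hσ
    rw [mul_left_cancel heq]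
  · intro w hw
    rw [hT] at hw
    obtain ⟨h1, h2, h3⟩ := hw
    obtain ⟨σ, hf, hσ⟩ := exists_fixesOutside_increasingOn l r w
    have hw : ∀ a, (σ⁻¹ * w).symm (σ.symm a) = w.symm a := fun a => by
      simp [Equiv.symm_apply_eq]
    have hlt : ∀ a b : Fin n, a < b → l ≤ (a : ℕ) → (b : ℕ) < r → w.symm a < w.symm b →
        σ.symm a < σ.symm b := by
      intro a b hab ha hb hlt
      have hab' := Fin.lt_def.1 hab
      rw [← hw a, ← hw b] at hlt
      by_contra hle
      rcases (not_lt.1 hle).lt_or_eq with hgt | he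
      · exact lt_asymm hlt (hσ _ _ hgt (hf.symm.apply_mem (by omega) (by omega)).1
          (hf.symm.apply_mem (by omega) (by omega)).2)
      · rw [he] at hlt
        exact lt_irrefl _ hlt
    refine ⟨(σ, σ⁻¹ * w), ?_, mul_inv_cancel_left _ _⟩
    rw [Finset.mem_product, hP, hQ]
    refine ⟨⟨hf, fun a b hab ha hb => ?_, fun a b hab ha hb => ?_⟩, hσ,
      fun a b hab ha hb => ?_⟩
    · exact hlt a b hab ha (by omega) (h1 a b hab ha hb)
    · exact hlt a b hab (by omega) hb (h2 a b hab ha hb)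
    · have hab' := Fin.lt_def.1 hab
      have hwa := hw a
      have hwb := hw b
      rw [hf.symm a (by omega)] at hwa
      rw [hf.symm b (by omega)] at hwb
      rw [hwa, hwb]
      exact h3 a b hab ha hb
  · rintro ⟨σ, τ⟩ -
    rw [MonoidAlgebra.single_mul_single, one_mul]

theorem isShuffleOn_iff {n l m r : ℕ} (hlm : l ≤ m) (hmr : m ≤ r) (σ : Equiv.Perm (Fin n)) :
    IsShuffleOn l (m - l) (r - m) σ ↔
      FixesOutside σ l r ∧ IncreasingOn σ l m ∧ IncreasingOn σ m r := by
  obtain ⟨p, rfl⟩ := Nat.exists_eq_add_of_le hlm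
  obtain ⟨q, rfl⟩ := Nat.exists_eq_add_of_le hmr
  rw [Nat.add_sub_cancel_left, Nat.add_sub_cancel_left]
  rfl

theorem fixesOutside_zero_self {n : ℕ} (σ : Equiv.Perm (Fin n)) : FixesOutside σ 0 n :=
  fun a ha => by omega

open scoped Classical in
theorem shuffleSum_eq_sum_filter (K : Type*) [CommRing K] (n i p q : ℕ) :
    shuffleSum K n i p q =
      ∑ σ ∈ Finset.univ.filter (IsShuffleOn (n := n) i p q), MonoidAlgebra.single σ (1 : K) :=
  (Finset.sum_filter _ _).symm

/-- for `1 ≤ i < j < n`, the identity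
`S_{j,n-j} · S_{i,j-i} = S_{i,n-i} · S_{j-i,n-j}^{↑i}` holds in `K[S_n]`.
(Permutations are composed in the paper's left-to-right convention, so the paper's
product `a · b` is `b * a` in terms of Lean's right-to-left composition `*`.) -/
theorem shuffle_sum_identity (K : Type*) [CommRing K] (n i j : ℕ)
    (hi : 1 ≤ i) (hij : i < j) (hj : j < n) :
    shuffleSum K n 0 i (j - i) * shuffleSum K n 0 j (n - j) =
      shuffleSum K n i (j - i) (n - j) * shuffleSum K n 0 i (n - i) := by
  classical
  have h0 : ∀ {m r : ℕ}, m ≤ r → ∀ σ : Equiv.Perm (Fin n), IsShuffleOn 0 m (r - m) σ ↔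
      FixesOutside σ 0 r ∧ IncreasingOn σ 0 m ∧ IncreasingOn σ m r :=
    fun hmr σ => isShuffleOn_iff (Nat.zero_le _) hmr σ
  let T : Finset (Equiv.Perm (Fin n)) := Finset.univ.filter fun σ =>
    IncreasingOn σ 0 i ∧ IncreasingOn σ i j ∧ IncreasingOn σ j n
  simp only [shuffleSum_eq_sum_filter]
  trans ∑ σ ∈ T, MonoidAlgebra.single σ (1 : K)
  · refine sum_single_mul_sum_single K (l := 0) (m := i) (r := j) (u := j) (v := n)
      (Nat.zero_le _) hij.le (Or.inr le_rfl) _ _ _ (fun σ => ?_) (fun σ => ?_) (fun σ => ?_)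
    · simp [h0 hij.le]
    · simp [h0 hj.le, fixesOutside_zero_self]
    · simp [T]
  · refine (sum_single_mul_sum_single K (l := i) (m := j) (r := n) (u := 0) (v := i)
      hij.le hj.le (Or.inl le_rfl) _ _ _ (fun σ => ?_) (fun σ => ?_) (fun σ => ?_)).symm
    · simp [isShuffleOn_iff hij.le hj.le]
    · simp [h0 (hij.trans hj).le, fixesOutside_zero_self, and_comm]
    · simp only [T, Finset.mem_filter, Finset.mem_univ, true_and]
      tauto
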